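/- Let q > 2 be a prime power and e_1, e_2, e_3 integers with gcd(q+1, e_3) = 1, gcd(q-1, e_2 - e_1) = 1, and e_3 ≡ e_1 + e_2 (mod q-1). Define T(a,b,c) = Σ_{y ∈ F_q^*} Σ_{x ∈ F_{q^2}^*} χ(y a x^{(q+1)e_1} + y b x^{(q+1)e_2}) χ'(y c x^{e_3}), where χ, χ' are the canonical additive characters of F_q and F_{q^2}. If c ≠ 0 and exactly one of a, b is zero, then T(a,b,c) = 1. If c ≠ 0, a, b ∈ F_q^*, and a = c^{q+1}/b, then T(a,b,c) = -q^2 + q + 1. If c ≠ 0, a, b ∈ F_q^*, and a ≠ c^{q+1}/b, then T(a,b,c) = q + 1. -/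

import Mathlib

/-- The canonical additive character of a finite field of characteristic `p`. -/
noncomputable def canAddChar (p : ℕ) (F : Type) [Field F] [Fintype F]
    [Algebra (ZMod p) F] (x : F) : ℂ :=
  Complex.exp (2 * Real.pi * Complex.I * ((Algebra.trace (ZMod p) F x).val : ℂ) / p)

/-- The character sum `T(a,b,c) = Σ_{y ∈ F^*} Σ_{x ∈ E^*}
`χ(y·a·N(x)^{e₁} + y·b·N(x)^{e₂})·χ'(y·c·x^{e₃})`, where `F = F_q`, `E = F_{q²}`,
`χ, χ'` are the canonical additive characters and `N = Algebra.norm F` (`N(x) = x^{q+1}`). -/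
noncomputable def Tsum (p : ℕ) (F E : Type) [Field F] [Fintype F] [DecidableEq F]
    [Field E] [Fintype E] [DecidableEq E] [Algebra (ZMod p) F] [Algebra (ZMod p) E]
    [Algebra F E] (e₁ e₂ e₃ : ℤ) (a b : F) (c : E) : ℂ :=
  ∑ y ∈ Finset.univ.filter (fun y : F => y ≠ 0),
    ∑ x ∈ Finset.univ.filter (fun x : E => x ≠ 0),
      canAddChar p F (y * a * (Algebra.norm F x) ^ e₁ + y * b * (Algebra.norm F x) ^ e₂) *
        canAddChar p E (algebraMap F E y * c * x ^ e₃)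

section Characters

open Finset

variable (p : ℕ) [Fact p.Prime] (F E : Type) [Field F] [Fintype F] [Field E] [Fintype E]
  [Algebra (ZMod p) F] [Algebra (ZMod p) E] [Algebra F E]

theorem canAddChar_eq_stdAddChar (x : F) :
    canAddChar p F x = ZMod.stdAddChar (Algebra.trace (ZMod p) F x) := by
  rw [ZMod.stdAddChar_apply, ZMod.toCircle_apply, canAddChar]

theorem canAddChar_add (x y : F) :
    canAddChar p F (x + y) = canAddChar p F x * canAddChar p F y := by
  simp only [canAddChar_eq_stdAddChar, map_add, AddChar.map_add_eq_mul]

theorem canAddChar_trace (x : E) :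
    canAddChar p F (Algebra.trace F E x) = canAddChar p E x := by
  have : IsScalarTower (ZMod p) F E :=
    IsScalarTower.of_algebraMap_eq' (Subsingleton.elim _ _)
  rw [canAddChar_eq_stdAddChar, canAddChar_eq_stdAddChar, Algebra.trace_trace]

theorem sum_canAddChar_mul [DecidableEq F] (g : F) :
    ∑ y : F, canAddChar p F (y * g) = if g = 0 then (Fintype.card F : ℂ) else 0 := by
  let ψ : AddChar F ℂ := (ZMod.stdAddChar (N := p)).compAddMonoidHom
    (Algebra.trace (ZMod p) F).toAddMonoidHom
  have hψ : ψ.IsPrimitive := by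
    apply AddChar.IsPrimitive.of_ne_one
    intro h
    obtain ⟨x, hx⟩ := Algebra.trace_surjective (ZMod p) F 1
    have h1 : ψ x = 1 := by rw [h, AddChar.one_apply]
    have h2 : ZMod.stdAddChar (1 : ZMod p) = ZMod.stdAddChar (0 : ZMod p) := by
      rw [AddChar.map_zero_eq_one, ← h1, ← hx]
      rfl
    exact one_ne_zero (ZMod.injective_stdAddChar h2)
  simp_rw [canAddChar_eq_stdAddChar]
  have := AddChar.sum_mulShift g hψ
  push_cast at this
  exact this

theorem sum_ne_zero_canAddChar_mul [DecidableEq F] (g : F) :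
    ∑ y ∈ univ.filter (fun y : F => y ≠ 0), canAddChar p F (y * g) =
      (if g = 0 then (Fintype.card F : ℂ) else 0) - 1 := by
  rw [← sum_canAddChar_mul p F g, filter_ne', ← sum_erase_add univ _ (mem_univ (0 : F))]
  simp [canAddChar]

/-- Summing over `y` first reduces the character sum to counting the zeros of a function. -/
theorem Tsum_eq_card [DecidableEq F] [DecidableEq E] (e₁ e₂ e₃ : ℤ) (a b : F) (c : E) :
    Tsum p F E e₁ e₂ e₃ a b c = Fintype.card F *
      #{x : E | x ≠ 0 ∧ a * Algebra.norm F x ^ e₁ + b * Algebra.norm F x ^ e₂ +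
        Algebra.trace F E (c * x ^ e₃) = 0} - (Fintype.card E - 1) := by
  have key (y : F) (x : E) :
      canAddChar p F (y * a * (Algebra.norm F x) ^ e₁ + y * b * (Algebra.norm F x) ^ e₂) *
        canAddChar p E (algebraMap F E y * c * x ^ e₃) =
      canAddChar p F (y * (a * Algebra.norm F x ^ e₁ + b * Algebra.norm F x ^ e₂ +
        Algebra.trace F E (c * x ^ e₃))) := by
    rw [← canAddChar_trace p F E, ← canAddChar_add, mul_assoc (algebraMap F E y),
      ← Algebra.smul_def, map_smul, smul_eq_mul]
    ring_nf
  simp_rw [Tsum, key]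
  rw [sum_comm]
  simp_rw [sum_ne_zero_canAddChar_mul]
  rw [sum_sub_distrib, ← sum_filter, filter_filter, sum_const, sum_const, filter_ne',
    card_erase_of_mem (mem_univ _), card_univ, nsmul_eq_mul, nsmul_eq_mul,
    Nat.cast_sub Fintype.card_pos]
  push_cast
  ring

end Characters

section NormTrace

open Finset

theorem card_norm_smul_add_one_fiber {F E : Type} [Field F] [DecidableEq F] [Field E]
    [Fintype E] [Algebra F E] {β : F} (hβ : β ≠ 0) (t : F) :
    #{z : E | Algebra.norm F (β • z + 1) = t} = #{z : E | Algebra.norm F z = t} := by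
  refine card_bij (fun z _ => β • z + 1) (fun z hz => by simpa using hz)
    (fun x _ y _ h => smul_right_injective E hβ (add_right_cancel h)) fun w hw => ?_
  have hw' : β • (β⁻¹ • (w - 1)) + 1 = w := by rw [smul_inv_smul₀ hβ, sub_add_cancel]
  exact ⟨β⁻¹ • (w - 1), by simpa [hw'] using hw, hw'⟩

variable {F E : Type} [Field F] [Fintype F] [Field E] [Fintype E] [Algebra F E]

theorem finrank_eq_two_of_card (hE : Fintype.card E = Fintype.card F ^ 2) :
    Module.finrank F E = 2 := by
  rw [Module.card_eq_pow_finrank (K := F) (V := E)] at hE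
  exact Nat.pow_right_injective Fintype.one_lt_card hE

theorem algebraMap_norm_quadratic (hE : Fintype.card E = Fintype.card F ^ 2) (x : E) :
    algebraMap F E (Algebra.norm F x) = x * x ^ Fintype.card F := by
  rw [FiniteField.algebraMap_norm_eq_prod_pow, finrank_eq_two_of_card hE]
  simp [prod_range_succ]

theorem algebraMap_trace_quadratic (hE : Fintype.card E = Fintype.card F ^ 2) (x : E) :
    algebraMap F E (Algebra.trace F E x) = x + x ^ Fintype.card F := by
  rw [FiniteField.algebraMap_trace_eq_sum_pow, finrank_eq_two_of_card hE]
  simp [sum_range_succ]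

theorem norm_smul_add_one (hE : Fintype.card E = Fintype.card F ^ 2) (β : F) (z : E) :
    Algebra.norm F (β • z + 1) =
      β * (β * Algebra.norm F z + Algebra.trace F E z) + 1 := by
  apply (algebraMap F E).injective
  have h : (β • z + 1) ^ Fintype.card F = β • z ^ Fintype.card F + 1 := by
    have := map_add (FiniteField.frobeniusAlgHom F E) (β • z) 1
    rw [map_smul, map_one] at this
    simpa using this
  simp only [map_add, map_mul, map_one, algebraMap_norm_quadratic hE,
    algebraMap_trace_quadratic hE, h]
  simp only [Algebra.smul_def]
  ring

variable [DecidableEq F]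

theorem card_trace_fiber (hE : Fintype.card E = Fintype.card F ^ 2) (t : F) :
    #{z : E | Algebra.trace F E z = t} = Fintype.card F := by
  have h := card_eq_sum_card_fiberwise (f := Algebra.trace F E) (s := (univ : Finset E))
    (t := univ) (fun _ _ => mem_coe.2 (mem_univ _))
  have hs := Algebra.trace_surjective F E
  rw [sum_congr rfl fun u _ =>
    AddMonoidHom.card_fiber_eq_of_mem_range (Algebra.trace F E) (hs u) (hs t),
    sum_const, card_univ, card_univ, hE, sq, smul_eq_mul] at h
  exact (Nat.eq_of_mul_eq_mul_left Fintype.card_pos h).symm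

theorem card_norm_fiber (hE : Fintype.card E = Fintype.card F ^ 2) [DecidableEq E]
    {t : F} (ht : t ≠ 0) :
    #{z : E | Algebra.norm F z = t} = Fintype.card F + 1 := by
  let f : Eˣ →* Fˣ := Units.map (Algebra.norm F)
  have hs : Function.Surjective f := FiniteField.unitsMap_norm_surjective F E
  have h := card_eq_sum_card_fiberwise (f := f) (s := univ) (t := univ)
    (fun _ _ => mem_coe.2 (mem_univ _))
  rw [sum_congr rfl fun u _ =>
    MonoidHom.card_fiber_eq_of_mem_range f (hs u) (hs (Units.mk0 t ht)),
    sum_const, card_univ, card_univ, Fintype.card_units, Fintype.card_units, hE,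
    smul_eq_mul] at h
  have hq : 1 < Fintype.card F := Fintype.one_lt_card
  have h' : Fintype.card F ^ 2 - 1 = (Fintype.card F - 1) * (Fintype.card F + 1) := by
    rw [mul_comm, ← Nat.sq_sub_sq, one_pow]
  rw [h'] at h
  rw [Nat.eq_of_mul_eq_mul_left (by lia) h]
  symm
  refine card_bij (fun u _ => (u : E)) ?_ (fun _ _ _ _ h => Units.ext h) ?_
  · intro u hu
    simpa [f, Units.ext_iff] using hu
  · intro z hz
    have hz' : Algebra.norm F z = t := by simpa using hz
    have hz0 : z ≠ 0 := by
      rintro rfl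
      exact ht (by rw [← hz', Algebra.norm_zero])
    exact ⟨Units.mk0 z hz0, by simpa [f, Units.ext_iff] using hz', rfl⟩

/-- The nonzero zeros of `a + β N(z) + Tr(z)` correspond, via `w = β z + 1`, to the solutions of
`N(w) = 1 - a β` with `w ≠ 1`. -/
theorem card_norm_trace_zeros (hE : Fintype.card E = Fintype.card F ^ 2) [DecidableEq E]
    (a : F) {β : F} (hβ : β ≠ 0) :
    #{z : E | z ≠ 0 ∧ a + β * Algebra.norm F z + Algebra.trace F E z = 0} =
      #{z : E | Algebra.norm F z = 1 - a * β} - if a = 0 then 1 else 0 := by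
  have hiff (z : E) : a + β * Algebra.norm F z + Algebra.trace F E z = 0 ↔
      Algebra.norm F (β • z + 1) = 1 - a * β := by
    rw [norm_smul_add_one hE, ← mul_right_inj' hβ, ← sub_eq_zero (b := 1 - a * β)]
    ring_nf
  simp_rw [hiff]
  rw [← card_norm_smul_add_one_fiber hβ, filter_and, filter_ne', erase_inter, univ_inter,
    card_erase_eq_ite]
  have h1 : (1 : F) = 1 - a * β ↔ a = 0 := by
    rw [eq_comm, sub_eq_self, mul_eq_zero, or_iff_left hβ]
  by_cases ha : a = 0 <;> simp [h1, ha]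

end NormTrace

section Substitution

open Finset

theorem eq_one_of_zpow_eq_one_of_gcd_eq_one {K : Type*} [Field K] {u : K} {m n : ℤ}
    (hu : u ≠ 0) (hm : u ^ m = 1) (hn : u ^ n = 1) (h : Int.gcd m n = 1) : u = 1 := by
  obtain ⟨r, s, hrs⟩ := Int.isCoprime_iff_gcd_eq_one.2 h
  rw [← zpow_one u, ← hrs, zpow_add₀ hu, mul_comm r, mul_comm s, zpow_mul, zpow_mul, hm, hn,
    one_zpow, one_zpow, one_mul]

theorem norm_zpow_of_finite {F E : Type*} [Field F] [Field E] [Algebra F E]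
    [Finite E] (x : E) (n : ℤ) :
    Algebra.norm F (x ^ n) = Algebra.norm F x ^ n :=
  map_zpow₀ ({ Algebra.norm F with map_zero' := Algebra.norm_zero } : E →*₀ F) x n

theorem norm_div_of_finite {F E : Type*} [Field F] [Field E] [Algebra F E]
    [Finite E] (x y : E) :
    Algebra.norm F (x / y) = Algebra.norm F x / Algebra.norm F y :=
  map_div₀ ({ Algebra.norm F with map_zero' := Algebra.norm_zero } : E →*₀ F) x y

variable {F E : Type} [Field F] [Fintype F] [Field E] [Fintype E] [Algebra F E]
  {e₁ e₂ e₃ : ℤ}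

theorem zpow_eq_zpow_add_of_dvd (hcong : ((Fintype.card F : ℤ) - 1) ∣ (e₃ - (e₁ + e₂)))
    {u : F} (hu : u ≠ 0) : u ^ e₃ = u ^ (e₁ + e₂) := by
  obtain ⟨k, hk⟩ := hcong
  have h1 : u ^ ((Fintype.card F : ℤ) - 1) = 1 := by
    rw [zpow_sub₀ hu, zpow_natCast, FiniteField.pow_card, zpow_one, div_self hu]
  rw [eq_add_of_sub_eq hk, zpow_add₀ hu, zpow_mul, h1, one_zpow, one_mul]

theorem norm_twisted_power (hE : Fintype.card E = Fintype.card F ^ 2)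
    (hcong : ((Fintype.card F : ℤ) - 1) ∣ (e₃ - (e₁ + e₂))) (c : E) {x : E} (hx : x ≠ 0) :
    Algebra.norm F ((Algebra.norm F x ^ e₁)⁻¹ • (c * x ^ e₃)) =
      Algebra.norm F c * Algebra.norm F x ^ (e₂ - e₁) := by
  have hN : Algebra.norm F x ≠ 0 := Algebra.norm_ne_zero_iff.2 hx
  rw [Algebra.smul_def, map_mul, Algebra.norm_algebraMap, finrank_eq_two_of_card hE, map_mul,
    norm_zpow_of_finite, zpow_eq_zpow_add_of_dvd hcong hN, zpow_sub₀ hN, zpow_add₀ hN]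
  have := zpow_ne_zero e₁ hN
  field_simp

/-- The power map `x ↦ c x^{e₃} N(x)^{-e₁}` is injective on `E^*`. -/
theorem twisted_power_injOn (hE : Fintype.card E = Fintype.card F ^ 2)
    (he₃ : Int.gcd (Fintype.card F + 1) e₃ = 1)
    (he₁₂ : Int.gcd (Fintype.card F - 1) (e₂ - e₁) = 1)
    (hcong : ((Fintype.card F : ℤ) - 1) ∣ (e₃ - (e₁ + e₂))) {c : E} (hc : c ≠ 0) :
    Set.InjOn (fun x : E => (Algebra.norm F x ^ e₁)⁻¹ • (c * x ^ e₃)) {x | x ≠ 0} := by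
  intro x (hx : x ≠ 0) y (hy : y ≠ 0) hxy
  have hNx : Algebra.norm F x ≠ 0 := Algebra.norm_ne_zero_iff.2 hx
  have hNy : Algebra.norm F y ≠ 0 := Algebra.norm_ne_zero_iff.2 hy
  have hNc : Algebra.norm F c ≠ 0 := Algebra.norm_ne_zero_iff.2 hc
  have hNt : Algebra.norm F (x / y) ≠ 0 := Algebra.norm_ne_zero_iff.2 (div_ne_zero hx hy)
  have hN : Algebra.norm F (x / y) = 1 := by
    have h := congrArg (Algebra.norm F) hxy
    simp only [norm_twisted_power hE hcong c hx, norm_twisted_power hE hcong c hy] at h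
    refine eq_one_of_zpow_eq_one_of_gcd_eq_one hNt ?_ ?_ he₁₂
    · rw [zpow_sub₀ hNt, zpow_natCast, FiniteField.pow_card, zpow_one, div_self hNt]
    · rw [norm_div_of_finite, div_zpow, mul_left_cancel₀ hNc h, div_self (zpow_ne_zero _ hNy)]
  have hNxy : Algebra.norm F x = Algebra.norm F y := by
    rwa [norm_div_of_finite, div_eq_one_iff_eq hNy] at hN
  simp only [hNxy] at hxy
  have hpow := mul_left_cancel₀ hc
    (smul_right_injective E (inv_ne_zero (zpow_ne_zero e₁ hNy)) hxy)
  refine (div_eq_one_iff_eq hy).1 (eq_one_of_zpow_eq_one_of_gcd_eq_one (div_ne_zero hx hy) ?_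
    (by rw [div_zpow, hpow, div_self (zpow_ne_zero _ hy)]) he₃)
  rw [zpow_add_one₀ (div_ne_zero hx hy), zpow_natCast, mul_comm,
    ← algebraMap_norm_quadratic hE, hN, map_one]

variable [DecidableEq F] [DecidableEq E]

theorem card_zeros_eq_card_norm_trace_zeros (hE : Fintype.card E = Fintype.card F ^ 2)
    (he₃ : Int.gcd (Fintype.card F + 1) e₃ = 1)
    (he₁₂ : Int.gcd (Fintype.card F - 1) (e₂ - e₁) = 1)
    (hcong : ((Fintype.card F : ℤ) - 1) ∣ (e₃ - (e₁ + e₂))) (a b : F) {c : E} (hc : c ≠ 0) :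
    #{x : E | x ≠ 0 ∧ a * Algebra.norm F x ^ e₁ + b * Algebra.norm F x ^ e₂ +
        Algebra.trace F E (c * x ^ e₃) = 0} =
      #{z : E | z ≠ 0 ∧ a + b / Algebra.norm F c * Algebra.norm F z +
        Algebra.trace F E z = 0} := by
  let φ : E → E := fun x => (Algebra.norm F x ^ e₁)⁻¹ • (c * x ^ e₃)
  have hinj : Set.InjOn φ (univ.filter (· ≠ 0) : Finset E) := by
    simpa using twisted_power_injOn hE he₃ he₁₂ hcong hc
  have himage : (univ.filter (· ≠ 0) : Finset E).image φ = univ.filter (· ≠ 0) := by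
    refine eq_of_subset_of_card_le (fun z hz => ?_) (card_image_of_injOn hinj).ge
    obtain ⟨x, hx, rfl⟩ := mem_image.1 hz
    have hx : x ≠ 0 := by simpa using hx
    simp [φ, hc, hx, zpow_ne_zero, Algebra.norm_eq_zero_iff]
  rw [← filter_filter, ← filter_filter (fun z : E => z ≠ 0)]
  conv_rhs => rw [← himage, filter_image,
    card_image_of_injOn (hinj.mono (coe_subset.2 (filter_subset _ _)))]
  congr 1
  refine filter_congr fun x hx => ?_
  have hx : x ≠ 0 := by simpa using hx
  have hNx : Algebra.norm F x ≠ 0 := Algebra.norm_ne_zero_iff.2 hx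
  have hNc : Algebra.norm F c ≠ 0 := Algebra.norm_ne_zero_iff.2 hc
  have hNe := zpow_ne_zero e₁ hNx
  rw [norm_twisted_power hE hcong c hx, map_smul, smul_eq_mul, zpow_sub₀ hNx]
  field_simp
  rw [mul_zero]

end Substitution

/-- Values of `T(a,b,c)` for `c ≠ 0`: it equals `1` when exactly one of `a, b` is zero,
`-q² + q + 1` when `a, b ∈ F_q^*` with `a = c^{q+1}/b`, and `q + 1` when `a, b ∈ F_q^*`
with `a ≠ c^{q+1}/b`.  Hypotheses: `q > 2`, `gcd(q+1, e₃) = 1`, `gcd(q-1, e₂-e₁) = 1`,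
`e₃ ≡ e₁ + e₂ (mod q-1)`. -/
theorem Tsum_values (p q : ℕ) [Fact p.Prime] (F E : Type) [Field F] [Fintype F]
    [DecidableEq F] [Field E] [Fintype E] [DecidableEq E] [Algebra (ZMod p) F]
    [Algebra (ZMod p) E] [Algebra F E] (hF : Fintype.card F = q) (hE : Fintype.card E = q ^ 2)
    (hq : 2 < q) (e₁ e₂ e₃ : ℤ) (he₃ : Int.gcd (q + 1) e₃ = 1)
    (he₁₂ : Int.gcd (q - 1) (e₂ - e₁) = 1) (hcong : ((q : ℤ) - 1) ∣ (e₃ - (e₁ + e₂)))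
    (a b : F) (c : E) (hc : c ≠ 0) :
    ((a = 0 ∧ b ≠ 0) ∨ (a ≠ 0 ∧ b = 0) →
        Tsum p F E e₁ e₂ e₃ a b c = 1) ∧
      (a ≠ 0 → b ≠ 0 → a = Algebra.norm F c / b →
        Tsum p F E e₁ e₂ e₃ a b c = -(q : ℂ) ^ 2 + q + 1) ∧
      (a ≠ 0 → b ≠ 0 → a ≠ Algebra.norm F c / b →
        Tsum p F E e₁ e₂ e₃ a b c = (q : ℂ) + 1) := by
  subst hF
  have hNc : Algebra.norm F c ≠ 0 := Algebra.norm_ne_zero_iff.2 hc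
  have hβ (hb : b ≠ 0) : b / Algebra.norm F c ≠ 0 := div_ne_zero hb hNc
  rw [Tsum_eq_card, card_zeros_eq_card_norm_trace_zeros hE he₃ he₁₂ hcong a b hc, hE]
  refine ⟨?_, fun ha hb hab => ?_, fun ha hb hab => ?_⟩
  · rintro (⟨rfl, hb⟩ | ⟨ha, rfl⟩)
    · rw [card_norm_trace_zeros hE 0 (hβ hb), zero_mul, sub_zero, card_norm_fiber hE one_ne_zero,
        if_pos rfl, Nat.add_sub_cancel]
      push_cast
      ring
    · have hfiber : Finset.univ.filter (fun z : E => z ≠ 0 ∧ a + 0 / Algebra.norm F c *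
          Algebra.norm F z + Algebra.trace F E z = 0) =
          Finset.univ.filter (fun z : E => Algebra.trace F E z = -a) := by
        refine Finset.filter_congr fun z _ => ?_
        rw [zero_div, zero_mul, add_zero, add_comm, add_eq_zero_iff_eq_neg, and_iff_right_iff_imp]
        rintro h rfl
        exact ha (by simpa using h)
      rw [hfiber, card_trace_fiber hE]
      push_cast
      ring
  · have hone : 1 - a * (b / Algebra.norm F c) = 0 := by
      rw [hab]
      field_simp
      ring
    rw [card_norm_trace_zeros hE a (hβ hb), hone, if_neg ha]
    simp only [Algebra.norm_eq_zero_iff, Finset.filter_eq', Finset.mem_univ, if_true,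
      Finset.card_singleton]
    push_cast
    ring
  · have hne : 1 - a * (b / Algebra.norm F c) ≠ 0 := fun h => hab <| by
      field_simp at h ⊢
      linear_combination -h
    rw [card_norm_trace_zeros hE a (hβ hb), card_norm_fiber hE hne, if_neg ha]
    push_cast
    ring
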